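/- Let R be a commutative noetherian ring, let a and b be ideals of R, and let X be an arbitrary R-module. Then cd(a+b, X) ≤ ara(a) + cd(b, X). -/

import Mathlib

open CategoryTheory

/-- The cohomological dimension `cd(a, X) = sup {i | H^i_a(X) ≠ 0}` of an `R`-module `X`
with respect to an ideal `a`. -/
noncomputable def cohDim {R : Type} [CommRing R] (a : Ideal R) (X : ModuleCat R) : ℕ :=
  sSup {i : ℕ | Nontrivial ((localCohomology a i).obj X)}

/-- The arithmetic rank `ara(a)`: the least number of elements of `R` generating an ideal with
the same radical as `a`. -/
noncomputable def araRank {R : Type} [CommRing R] (a : Ideal R) : ℕ :=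
  sInf {n : ℕ | ∃ f : Fin n → R, (Ideal.span (Set.range f)).radical = a.radical}


/-- Multiplication by `r` as a map `R/I → R/J`. -/
noncomputable def mulQ {R : Type} [CommRing R] (I J : Ideal R) (r : R)
    (h : ∀ y ∈ I, r * y ∈ J) : ModuleCat.of R (R ⧸ I) ⟶ ModuleCat.of R (R ⧸ J) :=
  ModuleCat.ofHom (Submodule.mapQ I J (LinearMap.lsmul R R r) h)

noncomputable def projQ {R : Type} [CommRing R] (I J : Ideal R) 
    (h : I ≤ J) : ModuleCat.of R (R ⧸ I) ⟶ ModuleCat.of R (R ⧸ J) :=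
  ModuleCat.ofHom (Submodule.mapQ I J LinearMap.id h)

lemma projQ_comp {R : Type} [CommRing R] (I J K : Ideal R) (h : I ≤ J) (h' : J ≤ K) :
    projQ I J h ≫ projQ J K h' = projQ I K (h.trans h') := by
  refine ModuleCat.hom_ext (LinearMap.ext fun x => ?_)
  obtain ⟨x, rfl⟩ := Submodule.Quotient.mk_surjective _ x
  rfl

lemma mulQ_projQ {R : Type} [CommRing R] (I J K : Ideal R) (r : R) (h) (h' : J ≤ K) :
    mulQ I J r h ≫ projQ J K h' = mulQ I K r (fun y hy => h' (h y hy)) := by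
  refine ModuleCat.hom_ext (LinearMap.ext fun x => ?_)
  obtain ⟨x, rfl⟩ := Submodule.Quotient.mk_surjective _ x
  rfl

lemma mulQ_mulQ {R : Type} [CommRing R] (I J K : Ideal R) (r s : R) (h h') :
    mulQ I J r h ≫ mulQ J K s h' = mulQ I K (s * r) 
      (fun y hy => by rw [mul_assoc]; exact h' _ (h y hy)) := by
  refine ModuleCat.hom_ext (LinearMap.ext fun x => ?_)
  obtain ⟨x, rfl⟩ := Submodule.Quotient.mk_surjective _ x
  change Submodule.Quotient.mk (s * (r * x)) = Submodule.Quotient.mk ((s * r) * x)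
  rw [mul_assoc]

/-- vanishing of the colimit of the Ext groups. -/
def Van {R : Type} [CommRing R] (b : Ideal R) (X : ModuleCat R) (i : ℕ) : Prop :=
  ∀ (J : Ideal R), b ≤ J.radical → ∀ e : Abelian.Ext (ModuleCat.of R (R ⧸ J)) X i,
    ∃ (J' : Ideal R) (h : J' ≤ J), b ≤ J'.radical ∧
      (Abelian.Ext.mk₀ (projQ J' J h)).comp e (zero_add i) = 0

/-- `0 → R/I → R/J → R/(J+r) → 0` where `I = (J : r)`. -/
noncomputable def colonSeq {R : Type} [CommRing R] (I J K : Ideal R) (r : R)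
    (hI : ∀ y, y ∈ I ↔ r * y ∈ J) (hK : K = J ⊔ Ideal.span {r}) :
    ShortComplex (ModuleCat R) :=
  ShortComplex.mk (mulQ I J r (fun y hy => (hI y).1 hy)) (projQ J K (hK ▸ le_sup_left))
    (by
      rw [mulQ_projQ]
      refine ModuleCat.hom_ext (LinearMap.ext fun x => ?_)
      obtain ⟨x, rfl⟩ := Submodule.Quotient.mk_surjective _ x
      change Submodule.Quotient.mk (r * x) = 0
      rw [Submodule.Quotient.mk_eq_zero, hK]
      exact Ideal.mul_mem_right _ _ (Ideal.mem_sup_right (Ideal.mem_span_singleton_self r)))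

lemma colonSeq_shortExact {R : Type} [CommRing R] (I J K : Ideal R) (r : R)
    (hI : ∀ y, y ∈ I ↔ r * y ∈ J) (hK : K = J ⊔ Ideal.span {r}) :
    (colonSeq I J K r hI hK).ShortExact where
  exact := by
    rw [ShortComplex.moduleCat_exact_iff]
    intro x hx
    obtain ⟨x, rfl⟩ := Submodule.Quotient.mk_surjective _ x
    replace hx : (Submodule.Quotient.mk x : R ⧸ K) = 0 := hx
    rw [Submodule.Quotient.mk_eq_zero, hK] at hx
    obtain ⟨j, hj, z, hz, rfl⟩ := Submodule.mem_sup.1 hx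
    obtain ⟨y, rfl⟩ := Ideal.mem_span_singleton'.1 hz
    refine ⟨(Submodule.Quotient.mk y : R ⧸ I), ?_⟩
    change (Submodule.Quotient.mk (r * y) : R ⧸ J) = Submodule.Quotient.mk (j + y * r)
    rw [Submodule.Quotient.eq]
    have : r * y - (j + y * r) = -j := by ring
    rw [this]
    exact J.neg_mem hj
  mono_f := by
    rw [ModuleCat.mono_iff_injective, injective_iff_map_eq_zero]
    intro x hx
    obtain ⟨x, rfl⟩ := Submodule.Quotient.mk_surjective _ x
    replace hx : (Submodule.Quotient.mk (r * x) : R ⧸ J) = 0 := hx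
    rw [Submodule.Quotient.mk_eq_zero] at hx
    exact (Submodule.Quotient.mk_eq_zero _).2 ((hI x).2 hx)
  epi_g := by
    rw [ModuleCat.epi_iff_surjective]
    intro x
    obtain ⟨x, rfl⟩ := Submodule.Quotient.mk_surjective _ x
    exact ⟨(Submodule.Quotient.mk x : R ⧸ J), rfl⟩

/-- Artin–Rees consequence. -/
lemma artinRees_colon {R : Type} [CommRing R] [IsNoetherianRing R] (b : Ideal R) (x : R)
    (t : ℕ) : ∃ k : ℕ, ∀ u : ℕ, ∃ N ≥ u, ∀ y, x ^ (t + k) * y ∈ b ^ N → x ^ k * y ∈ b ^ u := by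
  -- stabilization of annihilators
  let f : ℕ →o Ideal R := ⟨fun k => LinearMap.ker (LinearMap.lsmul R R (x ^ k)), by
    intro k l hkl y hy
    simp only [LinearMap.mem_ker, LinearMap.lsmul_apply, smul_eq_mul] at hy ⊢
    rw [← Nat.sub_add_cancel hkl, pow_add, mul_assoc, hy, mul_zero]⟩
  obtain ⟨k, hk⟩ := monotone_stabilizes_iff_noetherian.2 (inferInstance : IsNoetherian R R) f
  refine ⟨k, fun u => ?_⟩
  obtain ⟨c, hc⟩ := Ideal.exists_pow_inf_eq_pow_smul b (M := R) (Ideal.span {x ^ (t + k)})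
  refine ⟨u + c, by lia, fun y hy => ?_⟩
  have h1 : x ^ (t + k) * y ∈ b ^ (u + c) • (⊤ : Ideal R) ⊓ Ideal.span {x ^ (t + k)} := by
    refine ⟨by simpa using hy, Ideal.mul_mem_right _ _ (Ideal.mem_span_singleton_self _)⟩
  rw [hc _ (by lia), Nat.add_sub_cancel] at h1
  have h2 : x ^ (t + k) * y ∈ b ^ u * Ideal.span {x ^ (t + k)} :=
    Submodule.smul_mono le_rfl inf_le_right h1
  obtain ⟨w, hw, hwy⟩ := Ideal.mem_mul_span_singleton.1 h2
  have h3 : y - w ∈ f (t + k) := by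
    change x ^ (t + k) * (y - w) = 0
    rw [mul_sub, ← hwy]; ring
  rw [← hk (t + k) (by lia)] at h3
  have h4 : x ^ k * (y - w) = 0 := h3
  have : x ^ k * y = x ^ k * w := by rw [mul_sub] at h4; exact sub_eq_zero.1 h4
  rw [this]
  exact Ideal.mul_mem_left _ _ hw

lemma le_radical_pow' {R : Type} [CommRing R] (b : Ideal R) (n : ℕ) : b ≤ (b ^ n).radical :=
  fun _ hy => ⟨n, Ideal.pow_mem_pow hy n⟩

lemma extClass_comp_nat {R : Type} [CommRing R] {X : ModuleCat R}
    {S T : ShortComplex (ModuleCat R)} (hS : S.ShortExact) (hT : T.ShortExact) (φ : S ⟶ T)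
    {i j : ℕ} (e : Abelian.Ext T.X₁ X i) (h : 1 + i = j) :
    (Abelian.Ext.mk₀ φ.τ₃).comp (hT.extClass.comp e h) (zero_add _) =
      hS.extClass.comp ((Abelian.Ext.mk₀ φ.τ₁).comp e (zero_add _)) h := by
  rw [← Abelian.Ext.comp_assoc (a₁₂ := 1) _ _ _ (by lia) (by lia) (by lia),
    ← ShortComplex.ShortExact.extClass_naturality hS hT φ,
    Abelian.Ext.comp_assoc (a₂₃ := i) _ _ _ (by lia) (by lia) (by lia)]

lemma Van.step {R : Type} [CommRing R] [IsNoetherianRing R] {b : Ideal R} {X : ModuleCat R}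
    {i : ℕ} (x : R) (h0 : Van b X i) (h1 : Van b X (i + 1)) :
    Van (b ⊔ Ideal.span {x}) X (i + 1) := by
  intro J hJ e
  -- choose b^t, x^t
  obtain ⟨t₁, ht₁⟩ := Ideal.exists_pow_le_of_le_radical_of_fg (le_sup_left.trans hJ)
    (IsNoetherian.noetherian b)
  obtain ⟨t, ht⟩ : x ∈ J.radical := hJ (Ideal.mem_sup_right (Ideal.mem_span_singleton_self x))
  -- restrict to R/b^t₁
  obtain ⟨J₁, hJ₁, hb₁, he₁⟩ := h1 (b ^ t₁) (le_radical_pow' _ _)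
    ((Abelian.Ext.mk₀ (projQ _ _ ht₁)).comp e (zero_add _))
  let K₁ := J₁ ⊔ Ideal.span {x ^ t}
  have hK₁ : K₁ ≤ J := sup_le (hJ₁.trans ht₁) ((Ideal.span_singleton_le_iff_mem _).2 ht)
  let C₁ : Ideal R := Submodule.comap (LinearMap.lsmul R R (x ^ t)) J₁
  have hC₁ : ∀ y, y ∈ C₁ ↔ x ^ t * y ∈ J₁ := fun y => Iff.rfl
  have hJC₁ : J₁ ≤ C₁ := fun y hy => (hC₁ y).2 (J₁.mul_mem_left _ hy)
  have S₁ := colonSeq_shortExact C₁ J₁ K₁ (x ^ t) hC₁ rfl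
  obtain ⟨e', he'⟩ := Abelian.Ext.contravariant_sequence_exact₃ S₁ X
    ((Abelian.Ext.mk₀ (projQ K₁ J hK₁)).comp e (zero_add _))
    (by
      change (Abelian.Ext.mk₀ (projQ J₁ K₁ _)).comp _ _ = 0
      rw [Abelian.Ext.mk₀_comp_mk₀_assoc, projQ_comp] at he₁ ⊢
      exact he₁) (add_comm 1 i)
  change Abelian.Ext (ModuleCat.of R (R ⧸ C₁)) X i at e'
  obtain ⟨J₂, hJ₂, hb₂, he₂⟩ := h0 J₁ hb₁
    ((Abelian.Ext.mk₀ (projQ J₁ C₁ hJC₁)).comp e' (zero_add _))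
  obtain ⟨u, hu⟩ := Ideal.exists_pow_le_of_le_radical_of_fg hb₂ (IsNoetherian.noetherian b)
  obtain ⟨k, hk⟩ := artinRees_colon b x t
  obtain ⟨N, hN, hk⟩ := hk u
  let J₃ := b ^ N
  have hJ₃ : J₃ ≤ J₁ := ((Ideal.pow_le_pow_right hN).trans hu).trans hJ₂
  let C₃ : Ideal R := Submodule.comap (LinearMap.lsmul R R (x ^ (t + k))) J₃
  have hC₃ : ∀ y, y ∈ C₃ ↔ x ^ (t + k) * y ∈ J₃ := fun y => Iff.rfl
  let K₃ := J₃ ⊔ Ideal.span {x ^ (t + k)}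
  have hK₃ : K₃ ≤ K₁ := sup_le_sup hJ₃ (by
    rw [Ideal.span_singleton_le_span_singleton]
    exact pow_dvd_pow _ (by lia))
  have S₃ := colonSeq_shortExact C₃ J₃ K₃ (x ^ (t + k)) hC₃ rfl
  have hm : ∀ y ∈ C₃, x ^ k * y ∈ J₂ := fun y hy => hu (hk y ((hC₃ y).1 hy))
  let φ : colonSeq C₃ J₃ K₃ (x ^ (t + k)) hC₃ rfl ⟶ colonSeq C₁ J₁ K₁ (x ^ t) hC₁ rfl :=
    { τ₁ := mulQ C₃ C₁ (x ^ k) (fun y hy => hJC₁ (hJ₂ (hm y hy)))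
      τ₂ := projQ J₃ J₁ hJ₃
      τ₃ := projQ K₃ K₁ hK₃
      comm₁₂ := by
        change mulQ _ _ _ _ ≫ mulQ _ _ _ _ = mulQ _ _ _ _ ≫ projQ _ _ _
        rw [mulQ_mulQ, mulQ_projQ]
        congr 1
        rw [pow_add]
      comm₂₃ := by
        change projQ _ _ _ ≫ projQ _ _ _ = projQ _ _ _ ≫ projQ _ _ _
        rw [projQ_comp, projQ_comp] }
  have hφ : mulQ C₃ C₁ (x ^ k) (fun y hy => hJC₁ (hJ₂ (hm y hy))) = mulQ C₃ J₂ (x ^ k) hm ≫ projQ J₂ J₁ hJ₂ ≫ projQ J₁ C₁ hJC₁ := by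
    rw [projQ_comp, mulQ_projQ]
  refine ⟨K₃, hK₃.trans hK₁, ?_, ?_⟩
  · refine sup_le ((le_radical_pow' b N).trans (Ideal.radical_mono le_sup_left)) ?_
    rw [Ideal.span_singleton_le_iff_mem]
    exact ⟨t + k, Ideal.mem_sup_right (Ideal.mem_span_singleton_self _)⟩
  · have h5 : (Abelian.Ext.mk₀ (mulQ C₃ C₁ (x ^ k)
        (fun y hy => hJC₁ (hJ₂ (hm y hy))))).comp e' (zero_add _) = 0 := by
      rw [hφ]
      rw [← Abelian.Ext.mk₀_comp_mk₀_assoc, ← Abelian.Ext.mk₀_comp_mk₀_assoc, he₂,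
        Abelian.Ext.comp_zero]
    rw [← projQ_comp _ _ _ hK₃ hK₁, ← Abelian.Ext.mk₀_comp_mk₀_assoc, ← he']
    have h6 := extClass_comp_nat S₃ S₁ φ e' (add_comm 1 i)
    refine h6.trans ((congrArg (fun z => S₃.extClass.comp z (add_comm 1 i)) h5).trans ?_)
    exact Abelian.Ext.comp_zero _ _ _ _ _

lemma Van.finset {R : Type} [CommRing R] [IsNoetherianRing R] {X : ModuleCat R}
    {d : ℕ} (n : ℕ) (f : Fin n → R) (b : Ideal R) (h : ∀ i > d, Van b X i) :
    ∀ i > n + d, Van (Ideal.span (Set.range f) ⊔ b) X i := by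
  induction n with
  | zero =>
    intro i hi
    have : Ideal.span (Set.range f) ⊔ b = b := by simp
    rw [this]
    exact h i (by lia)
  | succ n ih =>
    intro i hi
    obtain ⟨j, rfl⟩ : ∃ j, i = j + 1 := ⟨i - 1, by lia⟩
    have : Ideal.span (Set.range f) ⊔ b =
        (Ideal.span (Set.range (fun j : Fin n => f j.succ)) ⊔ b) ⊔ Ideal.span {f 0} := by
      rw [Fin.range_fin_succ, Ideal.span_insert]
      rw [sup_assoc, sup_comm]; rfl
    rw [this]
    exact Van.step _ (ih _ _ (by lia)) (ih _ _ (by lia))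

lemma Van.bot {R : Type} [CommRing R] (X : ModuleCat R) (i : ℕ) (hi : i > 0) :
    Van (⊥ : Ideal R) X i := by
  intro J hJ e
  refine ⟨⊥, bot_le, bot_le, ?_⟩
  obtain ⟨j, rfl⟩ : ∃ j, i = j + 1 := ⟨i - 1, by lia⟩
  have : Projective (ModuleCat.of R R) := inferInstance
  have : Projective (ModuleCat.of R (R ⧸ (⊥ : Ideal R))) :=
    Projective.of_iso (Submodule.quotEquivOfEqBot (⊥ : Ideal R) rfl).symm.toModuleIso this
  exact Abelian.Ext.eq_zero_of_projective _

lemma Van.exists {R : Type} [CommRing R] [IsNoetherianRing R] (b : Ideal R) (X : ModuleCat R) :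
    ∃ n, ∀ i > n, Van b X i := by
  obtain ⟨n, f, hf⟩ := Submodule.fg_iff_exists_fin_generating_family.1 (IsNoetherian.noetherian b)
  refine ⟨n, fun i hi => ?_⟩
  have := Van.finset n f ⊥ (Van.bot X) i (by lia)
  rw [sup_bot_eq] at this
  rwa [← hf]

lemma Van.radical {R : Type} [CommRing R] (b c : Ideal R) (X : ModuleCat R) (i : ℕ)
    (hbc : b.radical = c.radical) (h : Van b X i) : Van c X i := by
  have key : ∀ J : Ideal R, b ≤ J.radical ↔ c ≤ J.radical := fun J => by
    rw [← Ideal.radical_le_radical_iff, hbc, Ideal.radical_le_radical_iff]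
  intro J hJ e
  obtain ⟨J', h1, h2, h3⟩ := h J ((key J).2 hJ) e
  exact ⟨J', h1, (key J').1 h2, h3⟩

lemma exists_cycle {R : Type} [CommRing R] (K : CochainComplex (ModuleCat R) ℕ) (i : ℕ)
    (x : K.X i) (hx : K.d i (i + 1) x = 0) : ∃ z : K.cycles i, K.iCycles i z = x := by
  have h := ShortComplex.exact_of_f_is_kernel
    (ShortComplex.mk (K.iCycles i) (K.d i (i + 1)) (by simp)) (K.cyclesIsKernel i (i + 1) (by simp))
  rw [ShortComplex.moduleCat_exact_iff] at h
  exact h x hx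

lemma homologyπ_zero_iff {R : Type} [CommRing R] (K : CochainComplex (ModuleCat R) ℕ) (p : ℕ)
    (z : K.cycles (p + 1)) :
    K.homologyπ (p + 1) z = 0 ↔ ∃ w : K.X p, K.d p (p + 1) w = K.iCycles (p + 1) z := by
  have h := ShortComplex.exact_of_g_is_cokernel
    (ShortComplex.mk (K.toCycles p (p + 1)) (K.homologyπ (p + 1)) (by simp))
    (K.homologyIsCokernel p (p + 1) (by simp))
  rw [ShortComplex.moduleCat_exact_iff] at h
  have hi : Function.Injective (K.iCycles (p + 1)) :=
    (ModuleCat.mono_iff_injective _).1 inferInstance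
  have hw : ∀ w, K.iCycles (p + 1) (K.toCycles p (p + 1) w) = K.d p (p + 1) w := fun w => by
    rw [← ConcreteCategory.comp_apply, K.toCycles_i]
  constructor
  · intro hz
    obtain ⟨w, rfl⟩ := h z hz
    exact ⟨w, (hw w).symm⟩
  · rintro ⟨w, hz⟩
    rw [← hw] at hz
    rw [← hi hz, ← ConcreteCategory.comp_apply]
    simp

lemma homologyπ_surj {R : Type} [CommRing R] (K : CochainComplex (ModuleCat R) ℕ) (i : ℕ) :
    Function.Surjective (K.homologyπ i) := (ModuleCat.epi_iff_surjective _).1 inferInstance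

/-- The cochain map induced on `Hom(-, X)` -/
noncomputable def homMap {R : Type} [CommRing R] {K L : ChainComplex (ModuleCat R) ℕ}
    (φ : K ⟶ L) (X : ModuleCat R) : L.linearYonedaObj R X ⟶ K.linearYonedaObj R X :=
  (HomologicalComplex.unopFunctor _ _).map
    ((((linearYoneda R (ModuleCat R)).obj X).rightOp.mapHomologicalComplex _).map φ).op

lemma homologyUnop_nat {R : Type} [CommRing R]
    {K L : HomologicalComplex (ModuleCat R)ᵒᵖ (ComplexShape.down ℕ)} (ψ : K ⟶ L) (n : ℕ) :
    (HomologicalComplex.homologyUnop L n).inv ≫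
      HomologicalComplex.homologyMap ((HomologicalComplex.unopFunctor _ _).map ψ.op) n =
      (HomologicalComplex.homologyMap ψ n).unop ≫
        (HomologicalComplex.homologyUnop K n).inv := by
  refine (Iso.inv_comp_eq (HomologicalComplex.homologyUnop L n)).2 ?_
  refine Eq.trans ?_ (Category.assoc _ _ _)
  refine (Iso.eq_comp_inv (HomologicalComplex.homologyUnop K n)).2 ?_
  exact congrArg Quiver.Hom.unop (HomologicalComplex.homologyOp_hom_naturality
    ((HomologicalComplex.unopFunctor _ _).map ψ.op) n).symm

lemma isoExt_naturality {R : Type} [CommRing R] {Y Y' : ModuleCat R} (g : Y' ⟶ Y)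
    (P : ProjectiveResolution Y) (P' : ProjectiveResolution Y')
    (φ : ProjectiveResolution.Hom P' P g) (X : ModuleCat R) (n : ℕ) :
    ((Ext R (ModuleCat R) n).map g.op).app X ≫ (P'.isoExt n X).hom =
      (P.isoExt n X).hom ≫ HomologicalComplex.homologyMap (homMap φ.hom X) n := by
  have h1 := ProjectiveResolution.isoLeftDerivedObj_inv_naturality g P' P φ.hom
    (by simpa using φ.hom_f_zero_comp_π_f_zero)
    ((linearYoneda R (ModuleCat R)).obj X).rightOp n
  let A := ((linearYoneda R (ModuleCat R)).obj X).rightOp.mapHomologicalComplex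
    (ComplexShape.down ℕ)
  have h3 : (HomologicalComplex.homologyUnop (A.obj P.complex) n).inv ≫
      HomologicalComplex.homologyMap (homMap φ.hom X) n =
      (HomologicalComplex.homologyMap (A.map φ.hom) n).unop ≫
        (HomologicalComplex.homologyUnop (A.obj P'.complex) n).inv := by
    exact homologyUnop_nat (A.map φ.hom) n
  have h1' : ((Ext R (ModuleCat R) n).map g.op).app X ≫ (P'.isoLeftDerivedObj
        ((linearYoneda R (ModuleCat R)).obj X).rightOp n).inv.unop =
      (P.isoLeftDerivedObj ((linearYoneda R (ModuleCat R)).obj X).rightOp n).inv.unop ≫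
      (HomologicalComplex.homologyMap (A.map φ.hom) n).unop := congrArg Quiver.Hom.unop h1
  change _ ≫ (_ ≫ (HomologicalComplex.homologyUnop (A.obj P'.complex) n).inv) =
    (_ ≫ (HomologicalComplex.homologyUnop (A.obj P.complex) n).inv) ≫ _
  refine (Category.assoc _ _ _).symm.trans ?_
  refine Eq.trans ?_ (Category.assoc _ _ _).symm
  refine Eq.trans (congrArg (· ≫ (HomologicalComplex.homologyUnop (A.obj P'.complex) n).inv)
    h1') ?_
  refine Eq.trans (Category.assoc _ _ _) ?_
  exact congrArg ((P.isoLeftDerivedObj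
    ((linearYoneda R (ModuleCat R)).obj X).rightOp n).inv.unop ≫ ·) h3.symm

lemma isoExt_hom_apply_zero {R : Type} [CommRing R] {Y Y' : ModuleCat R} (g : Y' ⟶ Y)
    (P : ProjectiveResolution Y) (P' : ProjectiveResolution Y')
    (φ : ProjectiveResolution.Hom P' P g) (X : ModuleCat R) (p : ℕ)
    (e : ((Ext R (ModuleCat R) (p + 1)).obj (.op Y)).obj X)
    (f : P.complex.X (p + 1) ⟶ X) (hf : P.complex.d (p + 2) (p + 1) ≫ f = 0)
    (z : (P.complex.linearYonedaObj R X).cycles (p + 1))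
    (hz : (P.isoExt (p + 1) X).hom e = (P.complex.linearYonedaObj R X).homologyπ (p + 1) z)
    (hzf : (P.complex.linearYonedaObj R X).iCycles (p + 1) z = f) :
    ((Ext R (ModuleCat R) (p + 1)).map g.op).app X e = 0 ↔
      (Abelian.Ext.mk₀ g).comp (P.extMk f (p + 2) rfl hf) (zero_add _) = 0 := by
  rw [ProjectiveResolution.mk₀_comp_extMk _ _ _ _ φ,
    ProjectiveResolution.extMk_eq_zero_iff _ _ _ _ _ p rfl]
  have inj : Function.Injective (P'.isoExt (R := R) (p + 1) X).hom :=
    (ModuleCat.mono_iff_injective (P'.isoExt (R := R) (p + 1) X).hom).1 inferInstance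
  have h1 : (P'.isoExt (p + 1) X).hom (((Ext R (ModuleCat R) (p + 1)).map g.op).app X e) =
      HomologicalComplex.homologyMap (homMap φ.hom X) (p + 1)
        ((P.isoExt (p + 1) X).hom e) := by
    exact congrArg (fun k => k.hom e) (isoExt_naturality g P P' φ X (p + 1))
  have h2 : HomologicalComplex.homologyMap (homMap φ.hom X) (p + 1)
        ((P.complex.linearYonedaObj R X).homologyπ (p + 1) z) =
        (P'.complex.linearYonedaObj R X).homologyπ (p + 1)
          (HomologicalComplex.cyclesMap (homMap φ.hom X) (p + 1) z) :=
    congrArg (fun k => k.hom z)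
      (HomologicalComplex.homologyπ_naturality (homMap φ.hom X) (p + 1))
  have h3 : (P'.complex.linearYonedaObj R X).iCycles (p + 1)
          (HomologicalComplex.cyclesMap (homMap φ.hom X) (p + 1) z) = φ.hom.f (p + 1) ≫ f := by
    refine (congrArg (fun k => k.hom z)
      (HomologicalComplex.cyclesMap_i (homMap φ.hom X) (p + 1))).trans ?_
    change (homMap φ.hom X).f (p + 1) ((P.complex.linearYonedaObj R X).iCycles (p + 1) z) = _
    rw [hzf]
    rfl
  rw [← inj.eq_iff, map_zero, h1, hz, h2, homologyπ_zero_iff, h3]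
  rfl

lemma bridge₁ {R : Type} [CommRing R] {Y : ModuleCat R} (X : ModuleCat R) (p : ℕ)
    (e : ((Ext R (ModuleCat R) (p + 1)).obj (.op Y)).obj X) :
    ∃ e' : Abelian.Ext Y X (p + 1), ∀ (Y' : ModuleCat R) (g : Y' ⟶ Y),
      ((Ext R (ModuleCat R) (p + 1)).map g.op).app X e = 0 ↔
      (Abelian.Ext.mk₀ g).comp e' (zero_add _) = 0 := by
  let P := projectiveResolution Y
  obtain ⟨z, hz⟩ := homologyπ_surj _ _ ((P.isoExt (p + 1) X).hom e)
  let f : P.complex.X (p + 1) ⟶ X := (P.complex.linearYonedaObj R X).iCycles (p + 1) z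
  have hf : P.complex.d (p + 2) (p + 1) ≫ f = 0 :=
    congrArg (fun k => k.hom z) ((P.complex.linearYonedaObj R X).iCycles_d (p + 1) (p + 2))
  refine ⟨P.extMk f (p + 2) rfl hf, fun Y' g => ?_⟩
  let P' := projectiveResolution Y'
  exact isoExt_hom_apply_zero g P P' ⟨ProjectiveResolution.lift g P' P, by
      have := ProjectiveResolution.lift_commutes_zero g P' P
      simp
      exact this⟩ X p e f hf z
    hz.symm rfl

lemma bridge₂ {R : Type} [CommRing R] {Y : ModuleCat R} (X : ModuleCat R) (p : ℕ)
    (e' : Abelian.Ext Y X (p + 1)) :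
    ∃ e : ((Ext R (ModuleCat R) (p + 1)).obj (.op Y)).obj X, ∀ (Y' : ModuleCat R) (g : Y' ⟶ Y),
      ((Ext R (ModuleCat R) (p + 1)).map g.op).app X e = 0 ↔
      (Abelian.Ext.mk₀ g).comp e' (zero_add _) = 0 := by
  let P := projectiveResolution Y
  obtain ⟨f, hf, rfl⟩ := P.extMk_surjective e' (p + 2) rfl
  obtain ⟨z, hz⟩ := exists_cycle (P.complex.linearYonedaObj R X) (p + 1) f hf
  refine ⟨(P.isoExt (p + 1) X).inv ((P.complex.linearYonedaObj R X).homologyπ (p + 1) z),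
    fun Y' g => ?_⟩
  let P' := projectiveResolution Y'
  refine isoExt_hom_apply_zero g P P' ⟨ProjectiveResolution.lift g P' P, by
      have := ProjectiveResolution.lift_commutes_zero g P' P
      simp
      exact this⟩ X p _ f hf z
    ?_ hz
  rw [← ConcreteCategory.comp_apply]
  simp

lemma colim_subsingleton_iff {R : Type} [CommRing R] {D : Type} [SmallCategory D] [IsFiltered D]
    (F : D ⥤ ModuleCat.{0} R) (c : Limits.Cocone F) (hc : Limits.IsColimit c) :
    Subsingleton c.pt ↔ ∀ (j : D) (e : F.obj j), ∃ (k : D) (f : j ⟶ k), F.map f e = 0 := by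
  constructor
  · intro h j e
    have := (Limits.Concrete.isColimit_rep_eq_iff_exists F hc e (0 : F.obj j)).1
      (h.elim _ _)
    obtain ⟨k, f, g, hfg⟩ := this
    exact ⟨k, f, by rw [hfg, map_zero]⟩
  · intro h
    refine subsingleton_of_forall_eq 0 fun y => ?_
    obtain ⟨j, e, rfl⟩ := Limits.Concrete.isColimit_exists_rep F hc y
    obtain ⟨k, f, hf⟩ := h j e
    rw [← c.w f, ConcreteCategory.comp_apply, hf, map_zero]

lemma van_of_subsingleton {R : Type} [CommRing R] [IsNoetherianRing R] (b : Ideal R)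
    (X : ModuleCat.{0} R) (p : ℕ) :
    Subsingleton ((localCohomology b (p + 1)).obj X) ↔ Van b X (p + 1) := by
  have key := colim_subsingleton_iff _ _ (Limits.isColimitOfPreserves
    ((evaluation (ModuleCat.{0} R) (ModuleCat.{0} R)).obj X)
    (Limits.colimit.isColimit
      (localCohomology.diagram (localCohomology.idealPowersDiagram b) (p + 1))))
  refine Iff.trans key ?_
  constructor
  · intro h J hJ e
    obtain ⟨t, ht⟩ := Ideal.exists_pow_le_of_le_radical_of_fg hJ (IsNoetherian.noetherian b)
    obtain ⟨e₁, he₁⟩ := bridge₂ X p ((Abelian.Ext.mk₀ (projQ (b ^ t) J ht)).comp e (zero_add _))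
    obtain ⟨k, f, hf⟩ := h (.op (.op t)) e₁
    have hk : t ≤ k.unop.unop := f.unop.unop.down.down
    refine ⟨b ^ k.unop.unop, (Ideal.pow_le_pow_right hk).trans ht, le_radical_pow' b _, ?_⟩
    have h2 := (he₁ _ (projQ (b ^ k.unop.unop) (b ^ t) (Ideal.pow_le_pow_right hk))).1 hf
    rw [Abelian.Ext.mk₀_comp_mk₀_assoc, projQ_comp] at h2
    exact h2
  · intro h j e
    obtain ⟨e', he'⟩ := bridge₁ (Y := ModuleCat.of R (R ⧸ b ^ j.unop.unop)) X p e
    obtain ⟨J', hJ', hr, h0⟩ := h (b ^ j.unop.unop) (le_radical_pow' b _) e'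
    obtain ⟨u, hu⟩ := Ideal.exists_pow_le_of_le_radical_of_fg hr (IsNoetherian.noetherian b)
    have hju : j.unop.unop ≤ j.unop.unop + u := Nat.le_add_right _ _
    refine ⟨.op (.op (j.unop.unop + u)), (homOfLE hju).op.op, ?_⟩
    have hle : b ^ (j.unop.unop + u) ≤ J' := (Ideal.pow_le_pow_right (Nat.le_add_left _ _)).trans hu
    refine (he' _ (projQ (b ^ (j.unop.unop + u)) (b ^ j.unop.unop)
      (Ideal.pow_le_pow_right hju))).2 ?_
    rw [← projQ_comp _ _ _ hle hJ', ← Abelian.Ext.mk₀_comp_mk₀_assoc, h0, Abelian.Ext.comp_zero]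

/-- Let `R` be a commutative noetherian ring, `a, b` ideals of `R` and `X` an
arbitrary `R`-module.  Then `cd(a + b, X) ≤ ara(a) + cd(b, X)`. -/
theorem statement4 {R : Type} [CommRing R] [IsNoetherianRing R] (a b : Ideal R)
    (X : ModuleCat R) :
    cohDim (a + b) X ≤ araRank a + cohDim b X := by
  obtain ⟨n, hn⟩ := Van.exists b X
  have hb : ∀ i > cohDim b X, Van b X i := by
    intro i hi
    obtain ⟨p, rfl⟩ : ∃ p, i = p + 1 := ⟨i - 1, by omega⟩
    rw [← van_of_subsingleton, ← not_nontrivial_iff_subsingleton]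
    intro hnt
    have hbdd : BddAbove {i : ℕ | Nontrivial ((localCohomology b i).obj X)} := by
      refine ⟨n, fun j hj => ?_⟩
      by_contra hlt
      obtain ⟨q, rfl⟩ : ∃ q, j = q + 1 := ⟨j - 1, by omega⟩
      have := (van_of_subsingleton b X q).2 (hn _ (by omega))
      exact (not_nontrivial_iff_subsingleton.2 this) hj
    have : p + 1 ≤ cohDim b X := le_csSup hbdd hnt
    omega
  have hne : {n : ℕ | ∃ f : Fin n → R,
      (Ideal.span (Set.range f)).radical = a.radical}.Nonempty := by
    obtain ⟨m, f, hf⟩ := Submodule.fg_iff_exists_fin_generating_family.1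
      (IsNoetherian.noetherian a)
    exact ⟨m, f, by rw [← hf]⟩
  obtain ⟨f, hf⟩ : ∃ f : Fin (araRank a) → R,
      (Ideal.span (Set.range f)).radical = a.radical := Nat.sInf_mem hne
  have hrad : (Ideal.span (Set.range f) ⊔ b).radical = (a + b).radical := by
    rw [Submodule.add_eq_sup, Ideal.radical_sup, hf, ← Ideal.radical_sup]
  have hab := Van.finset (araRank a) f b hb
  refine csSup_le' fun i hi => ?_
  by_contra hlt
  obtain ⟨q, rfl⟩ : ∃ q, i = q + 1 := ⟨i - 1, by omega⟩
  have := (van_of_subsingleton (a + b) X q).2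
    (Van.radical _ _ X _ hrad (hab _ (by omega)))
  exact (not_nontrivial_iff_subsingleton.2 this) hi
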